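/- Let ρ ∈ L^∞(ℝ²) with 0 ≤ ρ ≤ ρ^M, and suppose there exist R>0 and c>0 such that ∫_{B(x₀,R)} ρ(x) dx ≥ c for every x₀ ∈ ℝ². Then for every p ∈ [2,∞) there exists a constant C>0, depending only on p, R, c and ρ^M, such that for every continuously differentiable f:ℝ²→ℝ with f ∈ L²(ℝ²) and ∇f ∈ L²(ℝ²), one has ‖f‖_{L²(ℝ²)} + ‖∇f‖_{L²(ℝ²)} + ‖√ρ f‖_{L^p(ℝ²)} ≤ C ( ‖√ρ f‖_{L²(ℝ²)} + ‖∇f‖_{L²(ℝ²)} ). -/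

import Mathlib

open MeasureTheory

/-- The plane `ℝ²` with its Euclidean structure. -/
abbrev E2 := EuclideanSpace ℝ (Fin 2)

open scoped ENNReal NNReal

lemma shift_diff (f : E2 → ℝ) (hf : ContDiff ℝ 1 f) (h : E2) :
    ∫⁻ x, ‖f (x + h) - f x‖ₑ ^ (2:ℕ) ≤ ‖h‖ₑ ^ (2:ℕ) * ∫⁻ x, ‖fderiv ℝ f x‖ₑ ^ (2:ℕ) := by
  have hc : Continuous (fderiv ℝ f) := hf.continuous_fderiv one_ne_zero
  have key : ∀ x, ‖f (x + h) - f x‖ₑ ^ (2:ℕ) ≤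
      ∫⁻ t in Set.Ioc (0:ℝ) 1, ‖h‖ₑ ^ (2:ℕ) * ‖fderiv ℝ f (x + t • h)‖ₑ ^ (2:ℕ) := by
    intro x
    have hd : ∀ t : ℝ, HasDerivAt (fun t : ℝ => f (x + t • h)) (fderiv ℝ f (x + t • h) h) t := by
      intro t
      have h1 : HasDerivAt (fun t : ℝ => x + t • h) h t := by
        simpa using ((hasDerivAt_id t).smul_const h).const_add x
      exact ((hf.differentiable one_ne_zero (x + t • h)).hasFDerivAt).comp_hasDerivAt t h1
    have hcont : Continuous (fun t : ℝ => fderiv ℝ f (x + t • h) h) := by fun_prop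
    have hi := intervalIntegral.integral_eq_sub_of_hasDerivAt (a := 0) (b := 1)
      (fun t _ => hd t) (hcont.intervalIntegrable _ _)
    simp only [one_smul, zero_smul, add_zero] at hi
    rw [← hi, intervalIntegral.integral_of_le zero_le_one]
    have hmeas : AEMeasurable (fun t : ℝ => ‖fderiv ℝ f (x + t • h) h‖ₑ)
        (volume.restrict (Set.Ioc (0:ℝ) 1)) := by fun_prop
    have h2 : (∫⁻ t in Set.Ioc (0:ℝ) 1, ‖fderiv ℝ f (x + t • h) h‖ₑ) ^ (2:ℕ) ≤
        ∫⁻ t in Set.Ioc (0:ℝ) 1, ‖fderiv ℝ f (x + t • h) h‖ₑ ^ (2:ℕ) := by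
      have := ENNReal.lintegral_mul_le_Lp_mul_Lq (volume.restrict (Set.Ioc (0:ℝ) 1))
        Real.HolderConjugate.two_two hmeas (aemeasurable_const (b := (1:ℝ≥0∞)))
      simp at this
      calc _ ≤ _ := pow_le_pow_left₀ (zero_le) this 2
        _ = _ := by
          rw [← ENNReal.rpow_natCast, ← ENNReal.rpow_mul]; simp
    refine (pow_le_pow_left₀ zero_le (enorm_integral_le_lintegral_enorm _) 2).trans (h2.trans ?_)
    refine lintegral_mono fun t => ?_
    rw [← mul_pow, mul_comm]
    gcongr
    exact ContinuousLinearMap.le_opENorm _ _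
  refine (lintegral_mono key).trans ?_
  rw [lintegral_lintegral_swap (by
    apply Measurable.aemeasurable
    apply Continuous.measurable
    simp only [Function.uncurry_def]
    have : Continuous fun a : E2 × ℝ => ‖fderiv ℝ f (a.1 + a.2 • h)‖ₑ ^ 2 := by fun_prop
    exact ENNReal.continuous_const_mul (by simp) |>.comp this)]
  calc _ = ∫⁻ t in Set.Ioc (0:ℝ) 1, ‖h‖ₑ ^ (2:ℕ) * ∫⁻ x, ‖fderiv ℝ f x‖ₑ ^ (2:ℕ) := by
        refine lintegral_congr fun t => ?_
        rw [lintegral_const_mul' _ _ (by simp)]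
        rw [lintegral_add_right_eq_self (fun x => ‖fderiv ℝ f x‖ₑ ^ 2)]
    _ ≤ _ := by simp

lemma weighted_L2 (R c ρM : ℝ) (ρ f : E2 → ℝ) (hm : Measurable ρ)
    (h0 : ∀ x, 0 ≤ ρ x) (h1 : ∀ x, ρ x ≤ ρM)
    (hmass : ∀ x₀ : E2, c ≤ ∫ x in Metric.ball x₀ R, ρ x) (hf : ContDiff ℝ 1 f) :
    ENNReal.ofReal c * ∫⁻ x, ‖f x‖ₑ ^ (2:ℕ) ≤
      2 * volume (Metric.ball (0:E2) R) * (∫⁻ x, ENNReal.ofReal (ρ x) * ‖f x‖ₑ ^ (2:ℕ)) +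
      2 * ENNReal.ofReal ρM * volume (Metric.ball (0:E2) R) * ENNReal.ofReal R ^ (2:ℕ) *
        ∫⁻ x, ‖fderiv ℝ f x‖ₑ ^ (2:ℕ) := by
  have hfc := hf.continuous
  have hfm : Measurable f := hfc.measurable
  have hm1 : ∀ x : E2, ENNReal.ofReal c ≤ ∫⁻ h in Metric.ball (0:E2) R, ENNReal.ofReal (ρ (x + h)) := by
    intro x
    have hb : volume (Metric.ball x R) < ∞ := measure_ball_lt_top
    have hint : IntegrableOn ρ (Metric.ball x R) := by
      refine Measure.integrableOn_of_bounded (M := ρM) hb.ne hm.aestronglyMeasurable ?_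
      filter_upwards with y
      rw [Real.norm_of_nonneg (h0 y)]; exact h1 y
    calc _ ≤ ENNReal.ofReal (∫ x in Metric.ball x R, ρ x) := ENNReal.ofReal_le_ofReal (hmass x)
      _ = ∫⁻ y in Metric.ball x R, ENNReal.ofReal (ρ y) :=
        ofReal_integral_eq_lintegral_ofReal hint (by filter_upwards with y using h0 y)
      _ = _ := by
        rw [← lintegral_indicator measurableSet_ball, ← lintegral_indicator measurableSet_ball,
          ← lintegral_add_left_eq_self _ x]
        refine lintegral_congr fun h => ?_
        simp [Set.indicator]
  have hpt : ∀ x h : E2, ENNReal.ofReal (ρ (x + h)) * ‖f x‖ₑ ^ (2:ℕ) ≤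
      2 * (ENNReal.ofReal (ρ (x + h)) * ‖f (x + h)‖ₑ ^ (2:ℕ)) +
      2 * ENNReal.ofReal ρM * ‖f (x + h) - f x‖ₑ ^ (2:ℕ) := by
    intro x h
    have e : ∀ a : ℝ, ‖a‖ₑ ^ (2:ℕ) = ENNReal.ofReal (a ^ 2) := by
      intro a
      rw [← ofReal_norm, ← ENNReal.ofReal_pow (norm_nonneg _)]; simp
    have hM : 0 ≤ ρM := (h0 x).trans (h1 x)
    have t2 : (2:ℝ≥0∞) = ENNReal.ofReal 2 := by simp
    have := h0 (x + h)
    rw [e, e, e, show ∀ a b d : ℝ≥0∞, 2 * a + 2 * b * d = ENNReal.ofReal 2 * a + ENNReal.ofReal 2 * b * d from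
      fun a b d => by rw [← t2], ← ENNReal.ofReal_mul this, ← ENNReal.ofReal_mul this,
      ← ENNReal.ofReal_mul zero_le_two, ← ENNReal.ofReal_mul zero_le_two,
      ← ENNReal.ofReal_mul (by positivity), ← ENNReal.ofReal_add (by positivity) (by positivity)]
    apply ENNReal.ofReal_le_ofReal
    have a1 : f x ^ 2 ≤ 2 * f (x+h) ^ 2 + 2 * (f (x+h) - f x) ^ 2 := by
      nlinarith [sq_nonneg (2 * f (x+h) - f x)]
    have a2 := mul_le_mul_of_nonneg_left a1 this
    have a3 := mul_le_mul_of_nonneg_right (h1 (x+h)) (sq_nonneg (f (x+h) - f x))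
    linarith
  have hmA : Measurable fun a : E2 × E2 => ENNReal.ofReal (ρ (a.1 + a.2)) * ‖f (a.1 + a.2)‖ₑ ^ (2:ℕ) := by
    fun_prop
  have hmB : Measurable fun a : E2 × E2 => ‖f (a.1 + a.2) - f a.1‖ₑ ^ (2:ℕ) := by
    fun_prop
  calc ENNReal.ofReal c * ∫⁻ x, ‖f x‖ₑ ^ (2:ℕ)
      = ∫⁻ x, ENNReal.ofReal c * ‖f x‖ₑ ^ (2:ℕ) := by
        rw [lintegral_const_mul' _ _ (by simp)]
    _ ≤ ∫⁻ x, ∫⁻ h in Metric.ball (0:E2) R, ENNReal.ofReal (ρ (x + h)) * ‖f x‖ₑ ^ (2:ℕ) := by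
        refine lintegral_mono fun x => ?_
        rw [lintegral_mul_const' _ _ (by simp)]
        gcongr
        exact hm1 x
    _ ≤ ∫⁻ x, ∫⁻ h in Metric.ball (0:E2) R,
        (2 * (ENNReal.ofReal (ρ (x + h)) * ‖f (x + h)‖ₑ ^ (2:ℕ)) +
      2 * ENNReal.ofReal ρM * ‖f (x + h) - f x‖ₑ ^ (2:ℕ)) :=
        lintegral_mono fun x => lintegral_mono fun h => hpt x h
    _ = ∫⁻ h in Metric.ball (0:E2) R, ∫⁻ x,
        (2 * (ENNReal.ofReal (ρ (x + h)) * ‖f (x + h)‖ₑ ^ (2:ℕ)) +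
      2 * ENNReal.ofReal ρM * ‖f (x + h) - f x‖ₑ ^ (2:ℕ)) := by
        rw [lintegral_lintegral_swap]
        exact ((hmA.const_mul _).add (hmB.const_mul _)).aemeasurable
    _ ≤ ∫⁻ h in Metric.ball (0:E2) R,
        (2 * (∫⁻ x, ENNReal.ofReal (ρ x) * ‖f x‖ₑ ^ (2:ℕ)) +
        2 * ENNReal.ofReal ρM * (ENNReal.ofReal R ^ (2:ℕ) * ∫⁻ x, ‖fderiv ℝ f x‖ₑ ^ (2:ℕ))) := by
        refine setLIntegral_mono' measurableSet_ball fun h hh => ?_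
        rw [lintegral_add_left (by fun_prop), lintegral_const_mul' _ _ (by simp),
          lintegral_const_mul' _ _ (by finiteness),
          lintegral_add_right_eq_self (fun x => ENNReal.ofReal (ρ x) * ‖f x‖ₑ ^ (2:ℕ))]
        gcongr
        refine (shift_diff f hf h).trans ?_
        gcongr
        rw [← ofReal_norm]
        apply ENNReal.ofReal_le_ofReal
        simpa using (mem_ball_zero_iff.1 hh).le
    _ = _ := by
        rw [lintegral_const]; simp; ring

lemma sobolev (p : ℝ) (hp : 2 ≤ p) : ∃ C : ℝ≥0, ∀ f : E2 → ℝ, ContDiff ℝ 1 f →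
    ∫⁻ x, ‖f x‖ₑ ^ p ≤ C * (∫⁻ x, (‖f x‖ₑ ^ (2:ℕ) + ‖fderiv ℝ f x‖ₑ ^ (2:ℕ))) ^ (p / 2) := by
  have hp0 : 0 < p := by linarith
  obtain ⟨φ, -⟩ : ∃ φ : ContDiffBump (0 : E2), φ = φ := ⟨⟨1, 2, by norm_num, by norm_num⟩, rfl⟩
  have hφ : ContDiff ℝ 1 φ := φ.contDiff
  set S : Set E2 := Metric.closedBall 0 φ.rOut with hS
  have hSm : MeasurableSet S := Metric.isClosed_closedBall.measurableSet
  have hts : tsupport φ = S := φ.tsupport_eq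
  have hsup : Function.support φ ⊆ S := hts ▸ subset_tsupport _
  have hSb : Bornology.IsBounded S := Metric.isBounded_closedBall
  have hSf : volume S ≠ ∞ := hSb.measure_lt_top.ne
  obtain ⟨M, hM⟩ : ∃ M : ℝ≥0, ∀ x, ‖fderiv ℝ φ x‖ₑ ≤ M := by
    obtain ⟨M, hM⟩ := (φ.hasCompactSupport.fderiv ℝ).exists_bound_of_continuous
      (hφ.continuous_fderiv one_ne_zero)
    refine ⟨M.toNNReal, fun x => ?_⟩
    rw [← ofReal_norm]
    exact ENNReal.ofReal_le_ofReal (hM x)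
  -- exponent
  let q : ℝ≥0 := ⟨2 * p / (p + 2), by positivity⟩
  have hq : (q : ℝ) = 2 * p / (p + 2) := rfl
  let P : ℝ≥0 := ⟨p, hp0.le⟩
  have hP : (P : ℝ) = p := rfl
  have hP0 : P ≠ 0 := fun h => by rw [← NNReal.coe_eq_zero] at h; linarith
  have hq1 : 1 ≤ q := by
    rw [← NNReal.coe_le_coe, hq, NNReal.coe_one, le_div_iff₀ (by positivity)]; linarith
  have hq2' : q < 2 := by
    rw [← NNReal.coe_lt_coe, hq, div_lt_iff₀ (by positivity)]; push_cast; linarith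
  have hq2 : q < Module.finrank ℝ E2 := by simpa using hq2'
  have hqq : (q:ℝ)⁻¹ - (Module.finrank ℝ E2 : ℝ)⁻¹ ≤ (P : ℝ)⁻¹ := by
    rw [hq, hP]; simp; field_simp; linarith
  obtain ⟨K, hK⟩ : ∃ K : ℝ≥0, ∀ u : E2 → ℝ, ContDiff ℝ 1 u → Function.support u ⊆ S →
      ∫⁻ x, ‖u x‖ₑ ^ p ≤ K * (∫⁻ x in S, ‖fderiv ℝ u x‖ₑ ^ (2:ℕ)) ^ (p / 2) := by
    let C1 := eLpNormLESNormFDerivOfLeConst ℝ (volume : Measure E2) S q P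
    let V : ℝ≥0∞ := volume S ^ (1 / (q:ℝ) - 1 / 2)
    have hV : V ≠ ∞ := by
      refine ENNReal.rpow_ne_top_of_nonneg ?_ hSf
      rw [sub_nonneg]
      exact one_div_le_one_div_of_le (by positivity) hq2'.le
    refine ⟨((C1 : ℝ≥0∞) * V).toNNReal ^ p, fun u hu hus => ?_⟩
    have h1 := eLpNorm_le_eLpNorm_fderiv_of_le volume hu hus hq1 hq2 hqq hSb
    have hsd : Function.support (fderiv ℝ u) ⊆ S :=
      (support_fderiv_subset ℝ).trans (closure_minimal hus Metric.isClosed_closedBall)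
    have h2 : eLpNorm (fderiv ℝ u) q volume ≤ eLpNorm (fderiv ℝ u) 2 (volume.restrict S) * V := by
      rw [← eLpNorm_restrict_eq_of_support_subset (ε := E2 →L[ℝ] ℝ) (f := fderiv ℝ u) hsd]
      have := eLpNorm_le_eLpNorm_mul_rpow_measure_univ (μ := volume.restrict S)
        (p := (q:ℝ≥0∞)) (q := 2) (f := fderiv ℝ u) (by exact_mod_cast hq2'.le)
        (hu.continuous_fderiv one_ne_zero).aestronglyMeasurable
      simpa [V] using this
    have h3 : eLpNorm u P volume ≤
        ((C1 : ℝ≥0∞) * V) * eLpNorm (fderiv ℝ u) 2 (volume.restrict S) := by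
      refine h1.trans ?_
      rw [mul_assoc, mul_comm V]
      gcongr
    have h4 := ENNReal.rpow_le_rpow h3 hp0.le
    rw [ENNReal.mul_rpow_of_nonneg _ _ hp0.le] at h4
    have e1 : eLpNorm u P volume ^ p = ∫⁻ x, ‖u x‖ₑ ^ p := by
      have := eLpNorm_nnreal_pow_eq_lintegral (f := u) (μ := volume) hP0
      simpa [hP] using this
    have e2 : eLpNorm (fderiv ℝ u) 2 (volume.restrict S) ^ p =
        (∫⁻ x in S, ‖fderiv ℝ u x‖ₑ ^ (2:ℕ)) ^ (p / 2) := by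
      rw [eLpNorm_eq_lintegral_rpow_enorm_toReal (by simp) (by simp), ← ENNReal.rpow_mul]
      simp
      congr 1; ring
    rw [e1, e2] at h4
    refine h4.trans_eq ?_
    congr 1
    rw [ENNReal.coe_rpow_of_nonneg _ hp0.le, ENNReal.coe_toNNReal (by finiteness)]
  -- main
  set I : ℝ≥0∞ := ∫⁻ y, ‖φ y‖ₑ ^ p with hI
  have hI0 : I ≠ 0 := by
    rw [hI, ← pos_iff_ne_zero]
    rw [lintegral_pos_iff_support (by have := φ.continuous; fun_prop)]
    refine (Metric.measure_ball_pos volume (0:E2) φ.rOut_pos).trans_le (measure_mono ?_)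
    rw [← φ.support_eq]
    intro x hx
    simp only [Function.mem_support] at hx ⊢
    simp [ENNReal.rpow_eq_zero_iff, hx, hp0]
  have hIt : I ≠ ∞ := by
    have : I ≤ volume S := by
      rw [← setLIntegral_one, ← lintegral_indicator hSm]
      refine lintegral_mono fun x => ?_
      by_cases hx : x ∈ S
      · simp only [Set.indicator_of_mem hx]
        refine ENNReal.rpow_le_one ?_ hp0.le
        rw [← ofReal_norm, Real.norm_of_nonneg φ.nonneg]
        exact ENNReal.ofReal_le_one.2 φ.le_one
      · have : φ x = 0 := by
          by_contra h; exact hx (hsup h)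
        simp [this, hp0]
    exact ne_top_of_le_ne_top hSf this
  let D : ℝ≥0∞ := 2 * (1 + (M:ℝ≥0∞) ^ (2:ℕ))
  have hDt : D ≠ ∞ := by simp only [D]; finiteness
  let C : ℝ≥0∞ := I⁻¹ * (K * (D ^ (p / 2) * volume S))
  have hCt : C ≠ ∞ := by
    have : D ^ (p/2) ≠ ∞ := ENNReal.rpow_ne_top_of_nonneg (by positivity) hDt
    have : I⁻¹ ≠ ∞ := by simpa using hI0
    simp only [C]; finiteness
  refine ⟨C.toNNReal, fun f hf => ?_⟩
  rw [ENNReal.coe_toNNReal hCt]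
  have hfc := hf.continuous
  have hfm : Measurable f := hfc.measurable
  have hfd := hf.continuous_fderiv one_ne_zero
  have hφc := hφ.continuous
  set F : E2 → ℝ≥0∞ := fun x => ‖f x‖ₑ ^ (2:ℕ) + ‖fderiv ℝ f x‖ₑ ^ (2:ℕ) with hF
  have hFm : Measurable F := by fun_prop
  set A := ∫⁻ x, F x with hA
  have step : ∀ y, ∫⁻ x, ‖φ x‖ₑ ^ p * ‖f (x + y)‖ₑ ^ p ≤
      K * (D ^ (p/2) * (A ^ (p/2 - 1) * ∫⁻ x in S, F (x + y))) := by
    intro y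
    have hg : ContDiff ℝ 1 (fun x => f (x + y)) := hf.comp (contDiff_id.add contDiff_const)
    have hk := hK (fun x => φ x * f (x + y)) (hφ.mul hg)
      ((Function.support_mul_subset_left _ _).trans hsup)
    have e : ∀ x, ‖φ x * f (x + y)‖ₑ ^ p = ‖φ x‖ₑ ^ p * ‖f (x + y)‖ₑ ^ p := by
      intro x
      rw [enorm_mul, ENNReal.mul_rpow_of_nonneg _ _ hp0.le]
    simp_rw [e] at hk
    refine hk.trans ?_
    gcongr
    have hb : ∫⁻ x in S, ‖fderiv ℝ (fun x => φ x * f (x + y)) x‖ₑ ^ (2:ℕ) ≤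
        D * ∫⁻ x in S, F (x + y) := by
      rw [← lintegral_const_mul' _ _ hDt]
      refine lintegral_mono fun x => ?_
      have hd := (((hφ.differentiable one_ne_zero x).hasFDerivAt).mul
        ((hg.differentiable one_ne_zero x).hasFDerivAt)).fderiv
      have hd' : fderiv ℝ (fun x => φ x * f (x + y)) x =
          φ x • fderiv ℝ f (x + y) + f (x + y) • fderiv ℝ φ x := by
        rw [← fderiv_comp_add_right]; exact hd
      rw [hd']
      have l1 : ‖φ x • fderiv ℝ f (x + y) + f (x + y) • fderiv ℝ φ x‖ₑ ≤
          ‖fderiv ℝ f (x + y)‖ₑ + M * ‖f (x + y)‖ₑ := by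
        refine (enorm_add_le (E := E2 →L[ℝ] ℝ) _ _).trans ?_
        rw [enorm_smul, enorm_smul, mul_comm (M:ℝ≥0∞)]
        gcongr
        · refine mul_le_of_le_one_left zero_le ?_
          rw [← ofReal_norm, Real.norm_of_nonneg φ.nonneg]
          exact ENNReal.ofReal_le_one.2 φ.le_one
        · exact hM x
      refine (pow_le_pow_left₀ zero_le l1 2).trans ?_
      have l2 := ENNReal.rpow_add_le_mul_rpow_add_rpow (‖fderiv ℝ f (x + y)‖ₑ)
        (M * ‖f (x + y)‖ₑ) (p := 2) (by norm_num)
      norm_num at l2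
      refine l2.trans ?_
      simp only [D, F]
      rw [mul_assoc, mul_pow]
      gcongr
      rw [add_mul, one_mul]
      refine add_le_add le_add_self ?_
      gcongr
      exact le_self_add
    calc _ ≤ (D * ∫⁻ x in S, F (x + y)) ^ (p/2) := by gcongr
      _ = D ^ (p/2) * (∫⁻ x in S, F (x + y)) ^ (p/2) :=
        ENNReal.mul_rpow_of_nonneg _ _ (by positivity)
      _ ≤ _ := by
        gcongr
        have : p / 2 = (p/2 - 1) + 1 := by ring
        nth_rewrite 1 [this]
        rw [ENNReal.rpow_add_of_nonneg _ _ (by linarith) zero_le_one, ENNReal.rpow_one]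
        gcongr
        · linarith
        refine (setLIntegral_le_lintegral _ _).trans_eq ?_
        exact lintegral_add_right_eq_self F y
  have lhs : ∫⁻ y, ∫⁻ x, ‖φ x‖ₑ ^ p * ‖f (x + y)‖ₑ ^ p = I * ∫⁻ x, ‖f x‖ₑ ^ p := by
    rw [lintegral_lintegral_swap (by
      apply Measurable.aemeasurable; simp only [Function.uncurry_def]; fun_prop)]
    rw [hI, ← lintegral_mul_const _ (by fun_prop)]
    refine lintegral_congr fun x => ?_
    rw [lintegral_const_mul _ (by fun_prop), lintegral_add_left_eq_self (fun y => ‖f y‖ₑ ^ p)]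
  have rhs : ∫⁻ y, ∫⁻ x in S, F (x + y) = volume S * A := by
    rw [lintegral_lintegral_swap (by
      apply Measurable.aemeasurable; simp only [Function.uncurry_def]; fun_prop)]
    simp_rw [lintegral_add_left_eq_self F]
    simp [mul_comm, hA]
  have tot := lintegral_mono (μ := (volume : Measure E2)) step
  rw [lhs, lintegral_const_mul _ (by fun_prop), lintegral_const_mul _ (by fun_prop),
    lintegral_const_mul _ (by fun_prop), rhs] at tot
  have hAA : A ^ (p/2 - 1) * A = A ^ (p/2) := by
    nth_rewrite 2 [← ENNReal.rpow_one A]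
    rw [← ENNReal.rpow_add_of_nonneg _ _ (by linarith) zero_le_one]
    congr 1; ring
  calc _ = I⁻¹ * (I * ∫⁻ x, ‖f x‖ₑ ^ p) := by
        rw [← mul_assoc, ENNReal.inv_mul_cancel hI0 hIt, one_mul]
    _ ≤ I⁻¹ * (K * (D ^ (p/2) * (A ^ (p/2 - 1) * (volume S * A)))) := by gcongr
    _ = _ := by
      simp only [C]
      rw [← hAA]; ring

lemma sqrt_add_le' {x y : ℝ} (hx : 0 ≤ x) (hy : 0 ≤ y) :
    Real.sqrt (x + y) ≤ Real.sqrt x + Real.sqrt y := by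
  rw [Real.sqrt_le_left (by positivity)]
  nlinarith [Real.sq_sqrt hx, Real.sq_sqrt hy, mul_nonneg (Real.sqrt_nonneg x) (Real.sqrt_nonneg y)]

lemma enorm_sq_ofReal {E : Type*} [NormedAddCommGroup E] (a : E) :
    ‖a‖ₑ ^ (2:ℕ) = ENNReal.ofReal (‖a‖ ^ 2) := by
  rw [← ofReal_norm, ← ENNReal.ofReal_pow (norm_nonneg _)]

lemma norm_gradient_eq (f : E2 → ℝ) (x : E2) : ‖gradient f x‖ = ‖fderiv ℝ f x‖ := by
  simp [gradient]

/-- global control of `‖f‖_{L²} + ‖∇f‖_{L²} + ‖√ρ f‖_{L^p}` by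
`‖√ρ f‖_{L²} + ‖∇f‖_{L²}` when the nonnegative bounded weight `ρ` has mass at
least `c` on every ball of radius `R`.  The constant `C` depends only on
`p`, `R`, `c` and `ρM`. -/
theorem global_weighted_Poincare_uniform_mass
    (p R c ρM : ℝ) (hp : 2 ≤ p) (hR : 0 < R) (hc : 0 < c) (hρM : 0 < ρM) :
    ∃ C > 0, ∀ (ρ f : E2 → ℝ),
      Measurable ρ → (∀ x, 0 ≤ ρ x) → (∀ x, ρ x ≤ ρM) →
      (∀ x₀ : E2, c ≤ ∫ x in Metric.ball x₀ R, ρ x) →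
      ContDiff ℝ 1 f →
      Integrable (fun x => (f x) ^ 2) →
      Integrable (fun x => ‖gradient f x‖ ^ 2) →
      Real.sqrt (∫ x, (f x) ^ 2) + Real.sqrt (∫ x, ‖gradient f x‖ ^ 2)
          + (∫ x, |Real.sqrt (ρ x) * f x| ^ p) ^ (1 / p)
        ≤ C * (Real.sqrt (∫ x, (Real.sqrt (ρ x) * f x) ^ 2)
            + Real.sqrt (∫ x, ‖gradient f x‖ ^ 2)) := by
  obtain ⟨K, hK⟩ := sobolev p hp
  have hp0 : 0 < p := by linarith
  set V : ℝ := (volume (Metric.ball (0:E2) R)).toReal with hV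
  have hV0 : 0 ≤ V := ENNReal.toReal_nonneg
  have hVe : volume (Metric.ball (0:E2) R) = ENNReal.ofReal V :=
    (ENNReal.ofReal_toReal measure_ball_lt_top.ne).symm
  let a : ℝ := (2 * V + 2 * ρM * V * R ^ 2) / c
  have ha : 0 ≤ a := by positivity
  let b : ℝ := (ρM ^ (p / 2) * K) ^ (1 / p)
  have hb : 0 ≤ b := by positivity
  refine ⟨Real.sqrt a + 1 + b * (Real.sqrt a + 1), by positivity, ?_⟩
  intro ρ f hm h0 h1 hmass hf hf2 hg2
  have hfc := hf.continuous
  have hfm : Measurable f := hfc.measurable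
  set A := ∫ x, (f x) ^ 2 with hA
  set G := ∫ x, ‖gradient f x‖ ^ 2 with hG
  set W := ∫ x, (Real.sqrt (ρ x) * f x) ^ 2 with hW
  have hA0 : 0 ≤ A := integral_nonneg fun x => by positivity
  have hG0 : 0 ≤ G := integral_nonneg fun x => by positivity
  have hW0 : 0 ≤ W := integral_nonneg fun x => by positivity
  have eA : ∫⁻ x, ‖f x‖ₑ ^ (2:ℕ) = ENNReal.ofReal A := by
    rw [hA, ofReal_integral_eq_lintegral_ofReal hf2 (by filter_upwards with x; positivity)]
    exact lintegral_congr fun x => by rw [enorm_sq_ofReal]; simp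
  have eG : ∫⁻ x, ‖fderiv ℝ f x‖ₑ ^ (2:ℕ) = ENNReal.ofReal G := by
    rw [hG, ofReal_integral_eq_lintegral_ofReal hg2 (by filter_upwards with x; positivity)]
    exact lintegral_congr fun x => by rw [enorm_sq_ofReal, norm_gradient_eq]
  have sqρ : ∀ x, (Real.sqrt (ρ x) * f x) ^ 2 = ρ x * f x ^ 2 := fun x => by
    rw [mul_pow, Real.sq_sqrt (h0 x)]
  have hWi : Integrable (fun x => (Real.sqrt (ρ x) * f x) ^ 2) := by
    refine (hf2.const_mul ρM).mono' (by fun_prop) ?_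
    filter_upwards with x
    rw [Real.norm_of_nonneg (by positivity), sqρ]
    exact mul_le_mul_of_nonneg_right (h1 x) (sq_nonneg _)
  have eW : ∫⁻ x, ENNReal.ofReal (ρ x) * ‖f x‖ₑ ^ (2:ℕ) = ENNReal.ofReal W := by
    rw [hW, ofReal_integral_eq_lintegral_ofReal hWi (by filter_upwards with x; positivity)]
    exact lintegral_congr fun x => by
      rw [enorm_sq_ofReal, sqρ, ENNReal.ofReal_mul (h0 x)]; simp
  -- the `L²` bound
  have hL2 : c * A ≤ 2 * V * W + 2 * ρM * V * R ^ 2 * G := by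
    have := weighted_L2 R c ρM ρ f hm h0 h1 hmass hf
    rw [eA, eG, eW, hVe] at this
    have := ENNReal.toReal_mono (by finiteness) this
    rw [ENNReal.toReal_add (by finiteness) (by finiteness)] at this
    simpa [ENNReal.toReal_mul, ENNReal.toReal_ofReal, hc.le, hA0, hV0, hW0, hG0, hρM.le, hR.le]
      using this
  have hAle : A ≤ a * (W + G) := by
    have : c * A ≤ (2 * V + 2 * ρM * V * R ^ 2) * (W + G) := by
      have t1 : 0 ≤ 2 * V * G := by positivity
      have t2 : 0 ≤ 2 * ρM * V * R ^ 2 * W := by positivity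
      linarith
    simp only [a]
    rw [div_mul_eq_mul_div, le_div_iff₀ hc]
    linarith
  have hsWG : Real.sqrt (W + G) ≤ Real.sqrt W + Real.sqrt G := sqrt_add_le' hW0 hG0
  have hsA : Real.sqrt A ≤ Real.sqrt a * (Real.sqrt W + Real.sqrt G) := by
    refine (Real.sqrt_le_sqrt hAle).trans ?_
    rw [Real.sqrt_mul ha]
    gcongr
  -- the `L^p` bound
  have hLp : ∫ x, |Real.sqrt (ρ x) * f x| ^ p ≤ ρM ^ (p / 2) * (K * (A + G) ^ (p / 2)) := by
    have hmeas : Measurable fun x => |Real.sqrt (ρ x) * f x| ^ p :=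
      (measurable_norm.comp (hm.sqrt.mul hfm)).pow_const p
    rw [integral_eq_lintegral_of_nonneg_ae (by filter_upwards with x; positivity)
      hmeas.aestronglyMeasurable]
    refine ENNReal.toReal_le_of_le_ofReal (by positivity) ?_
    rw [ENNReal.ofReal_mul (by positivity), ENNReal.ofReal_mul (by positivity),
      ← ENNReal.ofReal_rpow_of_nonneg (add_nonneg hA0 hG0) (by positivity),
      ENNReal.ofReal_add hA0 hG0, ← eA, ← eG, ← lintegral_add_left (by fun_prop)]
    have := hK f hf
    rw [ENNReal.ofReal_coe_nnreal]
    refine le_trans ?_ (mul_le_mul_right this _)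
    rw [← lintegral_const_mul' _ _ (by simp)]
    refine lintegral_mono fun x => ?_
    rw [← ofReal_norm, ENNReal.ofReal_rpow_of_nonneg (norm_nonneg _) hp0.le,
      ← ENNReal.ofReal_mul (by positivity)]
    apply ENNReal.ofReal_le_ofReal
    rw [abs_mul, Real.mul_rpow (abs_nonneg _) (abs_nonneg _), Real.norm_eq_abs]
    gcongr
    rw [abs_of_nonneg (Real.sqrt_nonneg _), Real.sqrt_eq_rpow, ← Real.rpow_mul (h0 x),
      one_div_mul_eq_div]
    exact Real.rpow_le_rpow (h0 x) (h1 x) (by positivity)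
  have hLp' : (∫ x, |Real.sqrt (ρ x) * f x| ^ p) ^ (1 / p) ≤ b * Real.sqrt (A + G) := by
    refine (Real.rpow_le_rpow (integral_nonneg fun x => by positivity) hLp (by positivity)).trans_eq ?_
    rw [← mul_assoc, Real.mul_rpow (by positivity) (by positivity), ← Real.rpow_mul (by positivity),
      Real.sqrt_eq_rpow]
    congr 2
    field_simp
  have hsAG : Real.sqrt (A + G) ≤ Real.sqrt A + Real.sqrt G := sqrt_add_le' hA0 hG0
  have hs : Real.sqrt (A + G) ≤ (Real.sqrt a + 1) * (Real.sqrt W + Real.sqrt G) := by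
    have := Real.sqrt_nonneg W
    linarith
  have hfin := mul_le_mul_of_nonneg_left hs hb
  have := Real.sqrt_nonneg W
  linarith
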